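/- arXiv:1203.0201 — 10 statements merged into one kernel-verified Lean document; each statement's English description precedes it below -/
import Mathlib

section
/- Let h > π/√2 and π/√((2π/h)² + 1) < d < π. Then there exists k₀ ∈ (0, π) such that E⁺₍₋₁,₀₎(k₀) = E⁻₍₀,₀₎(k₀), this common value is strictly less than 9/4, and the product of derivatives (d/dk E⁺₍₋₁,₀₎)(k₀) · (d/dk E⁻₍₀,₀₎)(k₀) = ((k₀ − 2π)/(2h²)) · (k₀/(2h²)) is strictly negative. -/
open Real

/-- Band function of the upper decoupled waveguide (width π):
`E⁺_{m,p}(k) = ((k + 2πm)/(2h))² + (p + 1/2)²`. -/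
noncomputable def Eplus (h : ℝ) (m : ℤ) (p : ℕ) (k : ℝ) : ℝ :=
  ((k + 2 * Real.pi * (m : ℝ)) / (2 * h)) ^ 2 + ((p : ℝ) + 1 / 2) ^ 2

/-- Band function of the lower decoupled waveguide (width d):
`E⁻_{m,p}(k) = ((k + 2πm)/(2h))² + (π/d)²(p + 1/2)²`. -/
noncomputable def Eminus (h d : ℝ) (m : ℤ) (p : ℕ) (k : ℝ) : ℝ :=
  ((k + 2 * Real.pi * (m : ℝ)) / (2 * h)) ^ 2 + (Real.pi / d) ^ 2 * ((p : ℝ) + 1 / 2) ^ 2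

theorem stmt0 (h d : ℝ)
    (hh : h > Real.pi / Real.sqrt 2)
    (hd1 : Real.pi / Real.sqrt ((2 * Real.pi / h) ^ 2 + 1) < d)
    (hd2 : d < Real.pi) :
    ∃ k₀ ∈ Set.Ioo (0 : ℝ) Real.pi,
      Eplus h (-1) 0 k₀ = Eminus h d 0 0 k₀ ∧
      Eplus h (-1) 0 k₀ < 9 / 4 ∧
      deriv (Eplus h (-1) 0) k₀ * deriv (Eminus h d 0 0) k₀
        = ((k₀ - 2 * Real.pi) / (2 * h ^ 2)) * (k₀ / (2 * h ^ 2)) ∧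
      ((k₀ - 2 * Real.pi) / (2 * h ^ 2)) * (k₀ / (2 * h ^ 2)) < 0 := by
  have hpi := Real.pi_pos
  have hpos : 0 < h := lt_trans (by positivity) hh
  have hd : 0 < d := lt_trans (by positivity) hd1
  have hh2 : π ^ 2 < 2 * h ^ 2 := by
    rw [gt_iff_lt, div_lt_iff₀ (by positivity)] at hh
    have hsq := pow_lt_pow_left₀ hh hpi.le two_ne_zero
    rw [mul_pow, Real.sq_sqrt (by norm_num)] at hsq
    linarith
  have hA1 : 1 < (π / d) ^ 2 := one_lt_pow₀ ((one_lt_div hd).2 hd2) two_ne_zero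
  have hA2 : (π / d) ^ 2 < (2 * π / h) ^ 2 + 1 := by
    rw [div_lt_comm₀ (by positivity) hd] at hd1
    have hsq := pow_lt_pow_left₀ hd1 (by positivity) two_ne_zero
    rwa [Real.sq_sqrt (by positivity)] at hsq
  have hA3 : h ^ 2 * ((π / d) ^ 2 - 1) < 4 * π ^ 2 := by
    rw [div_pow (2 * π), ← sub_lt_iff_lt_add, lt_div_iff₀ (by positivity)] at hA2
    linarith
  have hderiv (a b k : ℝ) :
      deriv (fun x : ℝ => ((x + a) / (2 * h)) ^ 2 + b) k = (k + a) / (2 * h ^ 2) := by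
    have hd := ((((hasDerivAt_id k).add_const a).div_const (2 * h)).pow 2).add_const b
    refine Eq.trans (HasDerivAt.deriv hd) ?_
    norm_num
    field_simp
  obtain ⟨k, hk⟩ : ∃ k, 4 * π * (π - k) = h ^ 2 * ((π / d) ^ 2 - 1) :=
    ⟨π - h ^ 2 * ((π / d) ^ 2 - 1) / (4 * π), by field_simp; ring⟩
  have hk0 : 0 < k := by
    by_contra! hle
    nlinarith
  have hk1 : k < π := by
    have : 0 < 4 * π * (π - k) := hk ▸ mul_pos (by positivity) (sub_pos.2 hA1)
    linarith [pos_of_mul_pos_right this (by positivity)]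
  refine ⟨k, ⟨hk0, hk1⟩, ?_, ?_, ?_, ?_⟩
  · have hA : (π / d) ^ 2 = 1 + 4 * π * (π - k) / h ^ 2 := by
      rw [hk]
      field_simp
      ring
    simp only [Eplus, Eminus, hA]
    push_cast
    field_simp
    ring
  · have hlt : ((k + 2 * π * (-1)) / (2 * h)) ^ 2 < 2 := by
      rw [div_pow, div_lt_iff₀ (by positivity)]
      nlinarith
    simp only [Eplus]
    push_cast
    linarith
  · have h₁ := hderiv (2 * π * ((-1 : ℤ) : ℝ)) ((((0 : ℕ) : ℝ) + 1 / 2) ^ 2) k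
    have h₂ := hderiv (2 * π * ((0 : ℤ) : ℝ)) ((π / d) ^ 2 * (((0 : ℕ) : ℝ) + 1 / 2) ^ 2) k
    unfold Eplus Eminus
    rw [h₁, h₂]
    push_cast
    ring
  · exact mul_neg_of_neg_of_pos (div_neg_of_neg_of_pos (by linarith) (by positivity))
      (by positivity)
end

section
/- Let h > 0, 0 < d < π, k₀ ∈ (0, π), and m, n ∈ ℤ be such that E₀ := E⁺₍ₙ,₀₎(k₀) = E⁻₍ₘ,₀₎(k₀) and E₀ < 9/4. Then for every k' ∈ (−π, π], every n', m' ∈ ℤ, and every p, q ∈ ℤ≥0 satisfying E⁺₍ₙ',ₚ₎(k') = E₀ and E⁻₍ₘ',q₎(k') = E₀, one necessarily has p = q = 0 and either (k', n', m') = (k₀, n, m) or (k', n', m') = (−k₀, −n, −m). In particular, the crossing of band functions at level E₀ occurs only at the two quasimomenta ±k₀. -/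
/-- A multiple of `2π` by an integer that lies in `(-2π, 2π)` vanishes. -/
lemma int_eq_zero_of_abs_two_pi_mul_lt {j : ℤ} (hj : |2 * Real.pi * (j : ℝ)| < 2 * Real.pi) :
    j = 0 := by
  have hpi : 0 < 2 * Real.pi := Real.two_pi_pos
  rw [abs_mul, abs_of_pos hpi] at hj
  have h1 : |(j : ℝ)| < 1 := by
    by_contra! hle
    nlinarith
  exact Int.abs_lt_one_iff.mp (by exact_mod_cast h1)

/-- Up to a simultaneous sign change, `(k + 2πa)²` determines both `a` and the reduced
quasimomentum `k`. -/
lemma eq_or_eq_neg_of_sq_quasimomentum_eq {k k₀ : ℝ} (hk : k ∈ Set.Ioc (-Real.pi) Real.pi)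
    (hk₀ : k₀ ∈ Set.Ioo (0 : ℝ) Real.pi) {a b : ℤ}
    (hab : (k + 2 * Real.pi * (a : ℝ)) ^ 2 = (k₀ + 2 * Real.pi * (b : ℝ)) ^ 2) :
    (k = k₀ ∧ a = b) ∨ (k = -k₀ ∧ a = -b) := by
  obtain ⟨hk1, hk2⟩ := hk
  obtain ⟨hk3, hk4⟩ := hk₀
  rcases sq_eq_sq_iff_eq_or_eq_neg.mp hab with hpos | hneg
  · left
    have hj : b - a = 0 := int_eq_zero_of_abs_two_pi_mul_lt (by
      push_cast
      rw [abs_lt]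
      constructor <;> linarith)
    obtain rfl : a = b := by omega
    exact ⟨by linarith, rfl⟩
  · right
    have hj : a + b = 0 := int_eq_zero_of_abs_two_pi_mul_lt (by
      push_cast
      rw [abs_lt]
      constructor <;> linarith)
    obtain rfl : a = -b := by omega
    push_cast at hneg
    exact ⟨by linarith, rfl⟩

/-- Equal squared longitudinal momenta coincide after clearing the denominator `2h`. -/
lemma sq_eq_sq_of_div_two_mul {h x y : ℝ} (hh : 0 < h)
    (hxy : (x / (2 * h)) ^ 2 = (y / (2 * h)) ^ 2) : x ^ 2 = y ^ 2 := by
  have hne : (2 * h) ^ 2 ≠ 0 := by positivity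
  rw [div_pow, div_pow] at hxy
  exact (div_left_inj' hne).mp hxy

/-- Every transverse mode but the lowest has energy at least `9/4`. -/
lemma nine_fourths_le_sq_add_half {p : ℕ} (hp : p ≠ 0) : (9 / 4 : ℝ) ≤ ((p : ℝ) + 1 / 2) ^ 2 := by
  have h1 : (1 : ℝ) ≤ p := by exact_mod_cast Nat.one_le_iff_ne_zero.mpr hp
  nlinarith

theorem stmt1 (h d : ℝ) (hh : 0 < h) (hd : 0 < d) (hdπ : d < Real.pi)
    (k₀ : ℝ) (hk₀ : k₀ ∈ Set.Ioo (0 : ℝ) Real.pi) (m n : ℤ)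
    (E₀ : ℝ) (hE₀ : E₀ = Eplus h n 0 k₀)
    (hcross : Eplus h n 0 k₀ = Eminus h d m 0 k₀)
    (hE₀lt : E₀ < 9 / 4) :
    ∀ k' ∈ Set.Ioc (-Real.pi) Real.pi, ∀ (n' m' : ℤ) (p q : ℕ),
      Eplus h n' p k' = E₀ → Eminus h d m' q k' = E₀ →
      p = 0 ∧ q = 0 ∧
        ((k' = k₀ ∧ n' = n ∧ m' = m) ∨ (k' = -k₀ ∧ n' = -n ∧ m' = -m)) := by
  intro k' hk' n' m' p q hp hq
  have hp0 : p = 0 := by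
    by_contra hne
    have h1 := nine_fourths_le_sq_add_half hne
    have h2 := sq_nonneg ((k' + 2 * Real.pi * (n' : ℝ)) / (2 * h))
    unfold Eplus at hp
    linarith
  have hq0 : q = 0 := by
    by_contra hne
    have h1 := nine_fourths_le_sq_add_half hne
    have h2 := sq_nonneg ((k' + 2 * Real.pi * (m' : ℝ)) / (2 * h))
    have h3 : 1 ≤ (Real.pi / d) ^ 2 := one_le_pow₀ ((one_le_div hd).mpr hdπ.le)
    unfold Eminus at hq
    nlinarith
  subst hp0 hq0
  refine ⟨rfl, rfl, ?_⟩
  have hn := eq_or_eq_neg_of_sq_quasimomentum_eq hk' hk₀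
    (sq_eq_sq_of_div_two_mul hh (add_right_cancel (hp.trans hE₀)))
  have hm := eq_or_eq_neg_of_sq_quasimomentum_eq hk' hk₀
    (sq_eq_sq_of_div_two_mul hh (add_right_cancel (hq.trans (hE₀.trans hcross))))
  have hpos : 0 < k₀ := hk₀.1
  rcases hn with ⟨h1, h2⟩ | ⟨h1, h2⟩ <;> rcases hm with ⟨h3, h4⟩ | ⟨h3, h4⟩
  · exact Or.inl ⟨h1, h2, h4⟩
  · linarith
  · linarith
  · exact Or.inr ⟨h1, h2, h4⟩
end

section
/- For every k₀ ∈ (0, π) there exist h > 0, d ∈ (0, π), and m, n ∈ ℤ such that E⁺₍ₙ,₀₎(k₀) = E⁻₍ₘ,₀₎(k₀), this common value is strictly less than 9/4, and (2πn + k₀)(2πm + k₀) < 0 (i.e., the two band functions cross transversally at k₀ with slopes of opposite signs). -/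
theorem stmt2 (k₀ : ℝ) (hk₀ : k₀ ∈ Set.Ioo (0 : ℝ) Real.pi) :
    ∃ (h d : ℝ) (m n : ℤ), 0 < h ∧ d ∈ Set.Ioo (0 : ℝ) Real.pi ∧
      Eplus h n 0 k₀ = Eminus h d m 0 k₀ ∧
      Eplus h n 0 k₀ < 9 / 4 ∧
      (2 * Real.pi * (n : ℝ) + k₀) * (2 * Real.pi * (m : ℝ) + k₀) < 0 := by
  obtain ⟨h0, h1⟩ := hk₀
  have hpi := Real.pi_pos
  have hs : 1 < 2 - k₀ / Real.pi := by
    have := (div_lt_one hpi).2 h1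
    linarith
  have hsqrt : 1 < √(2 - k₀ / Real.pi) := Real.lt_sqrt_of_sq_lt (by simpa using hs)
  have hd : Real.pi / (Real.pi / √(2 - k₀ / Real.pi)) = √(2 - k₀ / Real.pi) :=
    div_div_cancel₀ hpi.ne'
  refine ⟨2 * Real.pi, Real.pi / √(2 - k₀ / Real.pi), 0, -1, by positivity,
    ⟨by positivity, div_lt_self hpi hsqrt⟩, ?_, ?_, ?_⟩
  · unfold Eplus Eminus
    rw [hd, Real.sq_sqrt (by linarith)]
    push_cast
    field_simp
    ring
  · have hlt : ((k₀ + 2 * Real.pi * ((-1 : ℤ) : ℝ)) / (2 * (2 * Real.pi))) ^ 2 < 1 := by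
      rw [sq_lt_one_iff_abs_lt_one, abs_lt, lt_div_iff₀ (by positivity),
        div_lt_iff₀ (by positivity)]
      push_cast
      constructor <;> linarith
    unfold Eplus
    rw [Nat.cast_zero]
    linarith
  · push_cast
    nlinarith
end

section
/- Let ζ > 0 and β₁, β₂ ∈ ℝ with β₁β₂ > 0, and set β = (β₁ − β₂)/(β₁ + β₂). Then the function f₁ attains its global minimum over ℝ exactly at the point t_min = (−2β/(β₁ + β₂))·√(ζ/(1 − β²)) + (1 − ζ)/(β₁ + β₂), the minimum value is f₁(t_min) = 2√(ζ(1 − β²)) − β(ζ − 1) − ζ − 1, and f₁(t) > f₁(t_min) for every t ≠ t_min. -/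
/-- `f₁(t) = t(β₁ − β₂) − (ζ + 1) + √((t(β₁ + β₂) + ζ − 1)² + 4ζ)`. -/
noncomputable def fOne (ζ β₁ β₂ t : ℝ) : ℝ :=
  t * (β₁ - β₂) - (ζ + 1) + Real.sqrt ((t * (β₁ + β₂) + ζ - 1) ^ 2 + 4 * ζ)

theorem sub_div_add_sq_lt_one {a b : ℝ} (h : 0 < a * b) :
    ((a - b) / (a + b)) ^ 2 < 1 := by
  have hs : 0 < (a + b) ^ 2 := by nlinarith [sq_nonneg (a - b)]
  rw [div_pow, div_lt_one hs]
  linarith [add_sq a b, sub_sq a b]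

/-- The substitution `u = t (β₁ + β₂) + ζ - 1` in `fOne`. -/
theorem fOne_eq {β₁ β₂ : ℝ} (hs : β₁ + β₂ ≠ 0) (ζ t : ℝ) :
    fOne ζ β₁ β₂ t =
      (β₁ - β₂) / (β₁ + β₂) * (t * (β₁ + β₂) + ζ - 1)
        + Real.sqrt ((t * (β₁ + β₂) + ζ - 1) ^ 2 + 4 * ζ)
        - (β₁ - β₂) / (β₁ + β₂) * (ζ - 1) - ζ - 1 := by
  have h : t * (β₁ - β₂) = (β₁ - β₂) / (β₁ + β₂) * (t * (β₁ + β₂)) := by field_simp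
  rw [fOne, h]
  ring

theorem two_mul_lt_mul_add_sqrt {q c β u : ℝ} (hc : c ^ 2 = 1 - β ^ 2)
    (hu : u * c + 2 * q * β ≠ 0) :
    2 * q * c < β * u + Real.sqrt (u ^ 2 + 4 * q ^ 2) := by
  have h : 2 * q * c - β * u < Real.sqrt (u ^ 2 + 4 * q ^ 2) := by
    apply Real.lt_sqrt_of_sq_lt
    have key : u ^ 2 + 4 * q ^ 2 - (2 * q * c - β * u) ^ 2 = (u * c + 2 * q * β) ^ 2 := by
      linear_combination -(u ^ 2 + 4 * q ^ 2) * hc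
    linarith [sq_pos_of_ne_zero hu]
  linarith

theorem mul_add_sqrt_eq {q c β u : ℝ} (hq : 0 ≤ q) (hc₀ : 0 < c) (hc : c ^ 2 = 1 - β ^ 2)
    (hu : u = -2 * β * (q / c)) :
    β * u + Real.sqrt (u ^ 2 + 4 * q ^ 2) = 2 * q * c := by
  have h : u ^ 2 + 4 * q ^ 2 = (2 * (q / c)) ^ 2 := by
    rw [hu]
    field_simp
    linear_combination 4 * q ^ 2 * hc
  rw [h, Real.sqrt_sq (by positivity), hu]
  field_simp
  linear_combination -q * hc

theorem stmt6 (ζ β₁ β₂ β tmin : ℝ) (hζ : 0 < ζ) (hββ : β₁ * β₂ > 0)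
    (hβ : β = (β₁ - β₂) / (β₁ + β₂))
    (htmin : tmin = (-2 * β / (β₁ + β₂)) * Real.sqrt (ζ / (1 - β ^ 2))
        + (1 - ζ) / (β₁ + β₂)) :
    fOne ζ β₁ β₂ tmin = 2 * Real.sqrt (ζ * (1 - β ^ 2)) - β * (ζ - 1) - ζ - 1 ∧
    ∀ t : ℝ, t ≠ tmin → fOne ζ β₁ β₂ t > fOne ζ β₁ β₂ tmin := by
  have hs : β₁ + β₂ ≠ 0 := by
    intro h
    rw [eq_neg_of_add_eq_zero_left h] at hββ
    linarith [mul_self_nonneg β₂]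
  have hβ₁ : 0 < 1 - β ^ 2 := by
    rw [hβ]
    linarith [sub_div_add_sq_lt_one hββ]
  have hc₀ : 0 < Real.sqrt (1 - β ^ 2) := Real.sqrt_pos.2 hβ₁
  have hc : Real.sqrt (1 - β ^ 2) ^ 2 = 1 - β ^ 2 := Real.sq_sqrt hβ₁.le
  have hq₀ : 0 ≤ Real.sqrt ζ := Real.sqrt_nonneg ζ
  have hq : Real.sqrt ζ ^ 2 = ζ := Real.sq_sqrt hζ.le
  rw [Real.sqrt_div hζ.le] at htmin
  rw [Real.sqrt_mul hζ.le]
  set c := Real.sqrt (1 - β ^ 2)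
  set q := Real.sqrt ζ
  have hu : tmin * (β₁ + β₂) + ζ - 1 = -2 * β * (q / c) := by
    rw [htmin]
    field_simp
    ring
  have hmin : fOne ζ β₁ β₂ tmin = 2 * (q * c) - β * (ζ - 1) - ζ - 1 := by
    have h := mul_add_sqrt_eq hq₀ hc₀ hc hu
    rw [hq] at h
    rw [fOne_eq hs, ← hβ, h]
    ring
  refine ⟨hmin, fun t ht => ?_⟩
  have hne : (t * (β₁ + β₂) + ζ - 1) * c + 2 * q * β ≠ 0 := by
    intro h
    have hut : t * (β₁ + β₂) + ζ - 1 = -2 * β * (q / c) := by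
      field_simp
      linarith
    exact ht (mul_right_cancel₀ hs (by linarith))
  have h := two_mul_lt_mul_add_sqrt hc hne
  rw [hq] at h
  rw [hmin, fOne_eq hs, ← hβ]
  linarith
end

section
/- Let ζ > 0 and β₁, β₂ ∈ ℝ with β₁β₂ > 0, and set β = (β₁ − β₂)/(β₁ + β₂). Then the function f₂ attains its global maximum over ℝ exactly at the point t_max = (2β/(β₁ + β₂))·√(ζ/(1 − β²)) + (1 − ζ)/(β₁ + β₂), the maximum value is f₂(t_max) = −2√(ζ(1 − β²)) − β(ζ − 1) − ζ − 1, and f₂(t) < f₂(t_max) for every t ≠ t_max. -/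
/-- `f₂(t) = t(β₁ − β₂) − (ζ + 1) − √((t(β₁ + β₂) + ζ − 1)² + 4ζ)`. -/
noncomputable def fTwo (ζ β₁ β₂ t : ℝ) : ℝ :=
  t * (β₁ - β₂) - (ζ + 1) - Real.sqrt ((t * (β₁ + β₂) + ζ - 1) ^ 2 + 4 * ζ)

theorem fTwo_eq_of_add_ne_zero {ζ β₁ β₂ : ℝ} (hs : β₁ + β₂ ≠ 0) (t : ℝ) :
    fTwo ζ β₁ β₂ t = (β₁ - β₂) / (β₁ + β₂) * (t * (β₁ + β₂) + ζ - 1)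
      - Real.sqrt ((t * (β₁ + β₂) + ζ - 1) ^ 2 + 4 * ζ)
      - (β₁ - β₂) / (β₁ + β₂) * (ζ - 1) - ζ - 1 := by
  unfold fTwo
  field_simp
  ring

theorem one_sub_div_sq_pos {β₁ β₂ : ℝ} (h : 0 < β₁ * β₂) :
    0 < 1 - ((β₁ - β₂) / (β₁ + β₂)) ^ 2 := by
  have hs : 0 < (β₁ + β₂) ^ 2 := by nlinarith [sq_nonneg (β₁ - β₂)]
  rw [div_pow, sub_pos, div_lt_one hs]
  nlinarith

/-- Strict Cauchy–Schwarz inequality for `(b, c)` and `(x, y)`, with `(b, c)` a unit vector. -/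
theorem add_mul_lt_sqrt_of_ne {b c x y : ℝ} (hbc : b ^ 2 + c ^ 2 = 1) (h : c * x ≠ b * y) :
    b * x + c * y < Real.sqrt (x ^ 2 + y ^ 2) := by
  apply Real.lt_sqrt_of_sq_lt
  have hpos : 0 < (c * x - b * y) ^ 2 := by
    have := sub_ne_zero.mpr h
    positivity
  have hid : x ^ 2 + y ^ 2 = (b * x + c * y) ^ 2 + (c * x - b * y) ^ 2 := by
    linear_combination (-(x ^ 2 + y ^ 2)) * hbc
  linarith

theorem stmt7 (ζ β₁ β₂ β tmax : ℝ) (hζ : 0 < ζ) (hββ : β₁ * β₂ > 0)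
    (hβ : β = (β₁ - β₂) / (β₁ + β₂))
    (htmax : tmax = (2 * β / (β₁ + β₂)) * Real.sqrt (ζ / (1 - β ^ 2))
        + (1 - ζ) / (β₁ + β₂)) :
    fTwo ζ β₁ β₂ tmax = -2 * Real.sqrt (ζ * (1 - β ^ 2)) - β * (ζ - 1) - ζ - 1 ∧
    ∀ t : ℝ, t ≠ tmax → fTwo ζ β₁ β₂ t < fTwo ζ β₁ β₂ tmax := by
  have hs : β₁ + β₂ ≠ 0 := fun h => by
    rw [eq_neg_of_add_eq_zero_left h] at hββ
    nlinarith [sq_nonneg β₂]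
  have hd : 0 < 1 - β ^ 2 := hβ ▸ one_sub_div_sq_pos hββ
  have hf := fTwo_eq_of_add_ne_zero (ζ := ζ) hs
  rw [← hβ] at hf
  rw [Real.sqrt_div hζ.le] at htmax
  rw [Real.sqrt_mul hζ.le]
  set q := Real.sqrt ζ
  set c := Real.sqrt (1 - β ^ 2)
  have hq0 : 0 < q := Real.sqrt_pos.mpr hζ
  have hc0 : 0 < c := Real.sqrt_pos.mpr hd
  have hq2 : q ^ 2 = ζ := Real.sq_sqrt hζ.le
  have hc2 : c ^ 2 = 1 - β ^ 2 := Real.sq_sqrt hd.le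
  have hx : tmax * (β₁ + β₂) + ζ - 1 = 2 * β * q / c := by
    rw [htmax]
    field_simp
    ring
  have hroot : Real.sqrt ((2 * β * q / c) ^ 2 + 4 * ζ) = 2 * q / c := by
    have hsq : (2 * β * q / c) ^ 2 + 4 * ζ = (2 * q / c) ^ 2 := by
      rw [← hq2]
      field_simp
      linear_combination 4 * hc2
    rw [hsq, Real.sqrt_sq (by positivity)]
  have hval : fTwo ζ β₁ β₂ tmax = -2 * (q * c) - β * (ζ - 1) - ζ - 1 := by
    rw [hf, hx, hroot]
    field_simp
    linear_combination 2 * q * hc2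
  refine ⟨hval, fun t ht => ?_⟩
  have hne : c * (t * (β₁ + β₂) + ζ - 1) ≠ β * (2 * q) := fun h => ht <| by
    have hxt : t * (β₁ + β₂) + ζ - 1 = tmax * (β₁ + β₂) + ζ - 1 := by
      rw [hx, eq_div_iff hc0.ne']
      linarith
    exact mul_right_cancel₀ hs (by linarith)
  have hlt := add_mul_lt_sqrt_of_ne (by linarith) hne
  rw [show (2 * q) ^ 2 = 4 * ζ by rw [← hq2]; ring] at hlt
  rw [hval, hf]
  linarith
end

section
/- Let ζ > 0 and β₁, β₂ ∈ ℝ with β₁β₂ > 0, and set β = (β₁ − β₂)/(β₁ + β₂). Then for all s, t ∈ ℝ one has f₁(t) − f₂(s) ≥ 4√(ζ(1 − β²)), and 4√(ζ(1 − β²)) > 0; that is, the range of f₁ is separated from the range of f₂ by a gap of length at least 4√(ζ(1 − β²)). -/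
theorem two_mul_sqrt_le_mul_add_sqrt {ζ b : ℝ} (hζ : 0 ≤ ζ) (hb : 0 ≤ 1 - b ^ 2) (u : ℝ) :
    2 * Real.sqrt (ζ * (1 - b ^ 2)) ≤ b * u + Real.sqrt (u ^ 2 + 4 * ζ) := by
  have hz := Real.sq_sqrt hζ
  have hc := Real.sq_sqrt hb
  rw [Real.sqrt_mul hζ]
  set z := Real.sqrt ζ
  set c := Real.sqrt (1 - b ^ 2)
  have key : 2 * (z * c) - b * u ≤ Real.sqrt (u ^ 2 + 4 * ζ) := by
    apply Real.le_sqrt_of_sq_le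
    have h : u ^ 2 + 4 * ζ - (2 * (z * c) - b * u) ^ 2 = (u * c + 2 * z * b) ^ 2 := by
      linear_combination (-4 * c ^ 2 - 4 * b ^ 2) * hz + (-u ^ 2 - 4 * ζ) * hc
    linarith [sq_nonneg (u * c + 2 * z * b)]
  linarith

theorem stmt8 (ζ β₁ β₂ β : ℝ) (hζ : 0 < ζ) (hββ : β₁ * β₂ > 0)
    (hβ : β = (β₁ - β₂) / (β₁ + β₂)) :
    (∀ s t : ℝ, fOne ζ β₁ β₂ t - fTwo ζ β₁ β₂ s ≥ 4 * Real.sqrt (ζ * (1 - β ^ 2))) ∧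
    4 * Real.sqrt (ζ * (1 - β ^ 2)) > 0 := by
  have hsum : β₁ + β₂ ≠ 0 := by
    intro h
    nlinarith [sq_nonneg (β₁ - β₂), congrArg (fun x => x ^ 2) h]
  have hpos : 0 < 1 - β ^ 2 := by
    have h : 1 - β ^ 2 = 4 * (β₁ * β₂) / (β₁ + β₂) ^ 2 := by
      rw [hβ]
      field_simp
      ring
    rw [h]
    positivity
  refine ⟨fun s t => ?_, by positivity⟩
  have hmul : β * (β₁ + β₂) = β₁ - β₂ := by
    rw [hβ, div_mul_cancel₀ _ hsum]
  have ht := two_mul_sqrt_le_mul_add_sqrt hζ.le hpos.le (t * (β₁ + β₂) + ζ - 1)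
  have hs := two_mul_sqrt_le_mul_add_sqrt (b := -β) hζ.le (by rw [neg_sq]; exact hpos.le)
    (s * (β₁ + β₂) + ζ - 1)
  rw [neg_sq] at hs
  unfold fOne fTwo
  rw [← hmul]
  linarith
end

section
/- Let ψ : ℝ → ℝ be infinitely smooth with ψ(s) = 1 for s ≤ 1/2 and ψ(s) = 0 for s ≥ 1, and let B₁ = sup over s ∈ ℝ of |ψ'(s)|. For 0 < ε < 1 define Φ_ε : ℝ² → ℝ by Φ_ε(x) = ψ(|ln‖x‖| / |ln ε|) for x ≠ 0 and Φ_ε(0) = 0. Then the integral over the unit ball {x ∈ ℝ² : ‖x‖ ≤ 1} of the Euclidean norm of the gradient ∇Φ_ε satisfies ∫ ‖∇Φ_ε(x)‖ dx ≤ 2π B₁ √ε / |ln ε|. -/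
open scoped Classical

/-- The cut-off function `Φ_ε(x) = ψ(|ln‖x‖| / |ln ε|)` for `x ≠ 0`, `Φ_ε(0) = 0`. -/
noncomputable def cutoff (ψ : ℝ → ℝ) (ε : ℝ) (x : EuclideanSpace ℝ (Fin 2)) : ℝ :=
  if x = 0 then 0 else ψ (|Real.log ‖x‖| / |Real.log ε|)

open MeasureTheory Set Filter Topology

/-- The derivative of a `C¹` function that is constant off a compact interval is bounded. -/
lemma bddAbove_range_abs_deriv_of_const {ψ : ℝ → ℝ} (hψ : ContDiff ℝ 1 ψ) {a b c d : ℝ}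
    (ha : ∀ s ≤ a, ψ s = c) (hb : ∀ s, b ≤ s → ψ s = d) :
    BddAbove (range fun s => |deriv ψ s|) := by
  have hsupp : HasCompactSupport (deriv ψ) := by
    refine HasCompactSupport.intro (isCompact_Icc (a := a) (b := b)) fun s hs => ?_
    rcases lt_or_ge s a with h | h
    · have : ψ =ᶠ[𝓝 s] fun _ => c := by
        filter_upwards [Iio_mem_nhds h] with t ht using ha t (le_of_lt ht)
      simpa using this.deriv_eq
    · have hbs : b < s := by
        by_contra! hsb
        exact hs ⟨h, hsb⟩
      have : ψ =ᶠ[𝓝 s] fun _ => d := by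
        filter_upwards [Ioi_mem_nhds hbs] with t ht using hb t (le_of_lt ht)
      simpa using this.deriv_eq
  exact (hψ.continuous_deriv le_rfl).abs.bddAbove_range_of_hasCompactSupport hsupp.norm

lemma norm_gradient {E : Type*} [NormedAddCommGroup E] [InnerProductSpace ℝ E] [CompleteSpace E]
    (f : E → ℝ) (x : E) : ‖gradient f x‖ = ‖fderiv ℝ f x‖ := by
  rw [← toDual_gradient, LinearIsometryEquiv.norm_map]

lemma norm_gradient_eq_zero_of_eventuallyEq_const {E : Type*} [NormedAddCommGroup E]
    [InnerProductSpace ℝ E] [CompleteSpace E] {f : E → ℝ} {x : E} {c : ℝ}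
    (h : f =ᶠ[𝓝 x] fun _ => c) : ‖gradient f x‖ = 0 := by
  rw [norm_gradient, h.fderiv_eq]
  simp

lemma norm_gradient_cutoff_le {ψ : ℝ → ℝ} (hψ : Differentiable ℝ ψ) {B ε : ℝ}
    (hB : ∀ s, |deriv ψ s| ≤ B) {x : EuclideanSpace ℝ (Fin 2)} (hx0 : x ≠ 0) (hx1 : ‖x‖ < 1) :
    ‖gradient (cutoff ψ ε) x‖ ≤ B / |Real.log ε| / ‖x‖ := by
  have hx : 0 < ‖x‖ := norm_pos_iff.2 hx0
  have heq : cutoff ψ ε =ᶠ[𝓝 x] (fun r => ψ (-Real.log r / |Real.log ε|)) ∘ (‖·‖) := by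
    filter_upwards [isOpen_compl_singleton.mem_nhds hx0,
      continuous_norm.continuousAt.eventually_lt continuousAt_const hx1] with y hy0 hy1
    have hy : y ≠ 0 := hy0
    simp only [cutoff, if_neg hy, Function.comp_apply]
    rw [abs_of_nonpos (Real.log_nonpos (norm_nonneg _) hy1.le)]
  have hn : DifferentiableAt ℝ (‖·‖) x := differentiableAt_id.norm ℝ hx0
  have hd : HasDerivAt (fun r => ψ (-Real.log r / |Real.log ε|))
      (deriv ψ (-Real.log ‖x‖ / |Real.log ε|) * (-(‖x‖)⁻¹ / |Real.log ε|)) ‖x‖ :=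
    (hψ _).hasDerivAt.comp ‖x‖ ((Real.hasDerivAt_log hx.ne').neg.div_const _)
  rw [norm_gradient, heq.fderiv_eq, (hd.comp_hasFDerivAt x hn.hasFDerivAt).fderiv, norm_smul,
    norm_fderiv_norm hn, mul_one, norm_mul, Real.norm_eq_abs, Real.norm_eq_abs, abs_div, abs_neg,
    abs_inv, abs_abs, abs_of_pos hx]
  calc _ ≤ B * (‖x‖⁻¹ / |Real.log ε|) := by gcongr; exact hB _
    _ = _ := by ring

lemma cutoff_eventuallyEq_zero {ψ : ℝ → ℝ} (hψ0 : ∀ s, 1 ≤ s → ψ s = 0) {ε : ℝ} (hε : 0 < ε)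
    (hε1 : ε < 1) : cutoff ψ ε =ᶠ[𝓝 0] fun _ => 0 := by
  filter_upwards [Metric.ball_mem_nhds 0 hε] with y hy
  rw [mem_ball_zero_iff] at hy
  rcases eq_or_ne y 0 with rfl | hy0
  · simp [cutoff]
  · have hlog : Real.log ‖y‖ ≤ Real.log ε := Real.log_le_log (norm_pos_iff.2 hy0) hy.le
    have hlogε : Real.log ε < 0 := Real.log_neg hε hε1
    rw [cutoff, if_neg hy0]
    refine hψ0 _ ?_
    rw [abs_of_neg hlogε, abs_of_neg (hlog.trans_lt hlogε), one_le_div (by linarith)]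
    linarith

lemma cutoff_eventuallyEq_one {ψ : ℝ → ℝ} (hψ1 : ∀ s, s ≤ 1 / 2 → ψ s = 1) {ε : ℝ} (hε : 0 < ε)
    (hε1 : ε < 1) {x : EuclideanSpace ℝ (Fin 2)} (hx : √ε < ‖x‖) (hx1 : ‖x‖ ≤ 1) :
    cutoff ψ ε =ᶠ[𝓝 x] fun _ => 1 := by
  have hsqrt : 0 < √ε := Real.sqrt_pos.2 hε
  have hlogε : Real.log ε < 0 := Real.log_neg hε hε1
  have hlt : ‖x‖ < (√ε)⁻¹ :=
    hx1.trans_lt ((one_lt_inv₀ hsqrt).2 ((Real.sqrt_lt_sqrt hε.le hε1).trans_eq Real.sqrt_one))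
  filter_upwards [continuousAt_const.eventually_lt continuous_norm.continuousAt hx,
    continuous_norm.continuousAt.eventually_lt continuousAt_const hlt] with y hy hy'
  have hpos : 0 < ‖y‖ := hsqrt.trans hy
  rw [cutoff, if_neg (norm_pos_iff.1 hpos)]
  refine hψ1 _ ?_
  have h1 := Real.log_le_log hsqrt hy.le
  have h2 := Real.log_le_log hpos hy'.le
  rw [Real.log_inv] at h2
  rw [Real.log_sqrt hε.le] at h1 h2
  rw [abs_of_neg hlogε, div_le_iff₀ (by linarith), abs_le]
  constructor <;> linarith

lemma eqOn_mul_indicator_div (C R : ℝ) :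
    EqOn (fun r : ℝ => r * (Iic R).indicator (fun r => C / r) r)
      ((Iic R).indicator fun _ => C) (Ioi 0) := by
  intro r hr
  have hr0 : r ≠ 0 := (mem_Ioi.1 hr).ne'
  by_cases h : r ≤ R
  · simp [indicator, h, mul_div_cancel₀ _ hr0]
  · simp [indicator, h]

lemma integrable_indicator_div_norm (C R : ℝ) :
    Integrable fun x : EuclideanSpace ℝ (Fin 2) => (Iic R).indicator (fun r => C / r) ‖x‖ := by
  rw [integrable_fun_norm_addHaar volume (f := (Iic R).indicator fun r => C / r)]
  simp only [finrank_euclideanSpace_fin, Nat.add_one_sub_one, pow_one, smul_eq_mul]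
  rw [integrableOn_congr_fun (eqOn_mul_indicator_div C R) measurableSet_Ioi, IntegrableOn,
    integrable_indicator_iff measurableSet_Iic, IntegrableOn,
    Measure.restrict_restrict measurableSet_Iic, Iic_inter_Ioi]
  exact integrable_const C

lemma integral_indicator_div_norm (C : ℝ) {R : ℝ} (hR : 0 ≤ R) :
    ∫ x : EuclideanSpace ℝ (Fin 2), (Iic R).indicator (fun r => C / r) ‖x‖ =
      2 * Real.pi * C * R := by
  rw [integral_fun_norm_addHaar volume ((Iic R).indicator fun r => C / r)]
  simp only [finrank_euclideanSpace_fin, Nat.add_one_sub_one, pow_one, smul_eq_mul]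
  rw [setIntegral_congr_fun measurableSet_Ioi (eqOn_mul_indicator_div C R),
    integral_indicator measurableSet_Iic, Measure.restrict_restrict measurableSet_Iic,
    Iic_inter_Ioi]
  simp [Measure.real, hR, EuclideanSpace.volume_ball_fin_two, Real.pi_nonneg]
  ring

theorem stmt11 (ψ : ℝ → ℝ) (hψ : ContDiff ℝ (⊤ : ℕ∞) ψ)
    (hψ1 : ∀ s : ℝ, s ≤ 1 / 2 → ψ s = 1) (hψ0 : ∀ s : ℝ, 1 ≤ s → ψ s = 0)
    (B₁ : ℝ) (hB₁ : B₁ = ⨆ s : ℝ, |deriv ψ s|)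
    (ε : ℝ) (hε : 0 < ε) (hε1 : ε < 1) :
    ∫ x in Metric.closedBall (0 : EuclideanSpace ℝ (Fin 2)) 1,
        ‖gradient (cutoff ψ ε) x‖
      ≤ 2 * Real.pi * B₁ * Real.sqrt ε / |Real.log ε| := by
  have hbdd := bddAbove_range_abs_deriv_of_const (hψ.of_le (by exact_mod_cast le_top)) hψ1 hψ0
  have hB : ∀ s, |deriv ψ s| ≤ B₁ := fun s => hB₁ ▸ le_ciSup hbdd s
  have hB0 : 0 ≤ B₁ := (abs_nonneg _).trans (hB 0)
  have hsqrt1 : √ε < 1 := (Real.sqrt_lt_sqrt hε.le hε1).trans_eq Real.sqrt_one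
  set C := B₁ / |Real.log ε|
  have hnonneg (x : EuclideanSpace ℝ (Fin 2)) :
      0 ≤ (Iic √ε).indicator (fun r => C / r) ‖x‖ :=
    indicator_apply_nonneg fun _ => by positivity
  calc
    _ ≤ ∫ x in Metric.closedBall (0 : EuclideanSpace ℝ (Fin 2)) 1,
        (Iic √ε).indicator (fun r => C / r) ‖x‖ := by
      refine integral_mono_of_nonneg (.of_forall fun _ => norm_nonneg _)
        (integrable_indicator_div_norm C √ε).integrableOn ?_
      filter_upwards [ae_restrict_mem Metric.isClosed_closedBall.measurableSet] with x hx
      rw [mem_closedBall_zero_iff] at hx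
      rcases eq_or_ne x 0 with rfl | hx0
      · exact (norm_gradient_eq_zero_of_eventuallyEq_const
          (cutoff_eventuallyEq_zero hψ0 hε hε1)).le.trans (hnonneg 0)
      · rcases le_or_gt ‖x‖ √ε with h | h
        · rw [indicator_of_mem (mem_Iic.2 h)]
          exact norm_gradient_cutoff_le (hψ.differentiable (by simp)) hB hx0
            (h.trans_lt hsqrt1)
        · exact (norm_gradient_eq_zero_of_eventuallyEq_const
            (cutoff_eventuallyEq_one hψ1 hε hε1 h hx)).le.trans (hnonneg x)
    _ ≤ ∫ x : EuclideanSpace ℝ (Fin 2), (Iic √ε).indicator (fun r => C / r) ‖x‖ :=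
      setIntegral_le_integral (integrable_indicator_div_norm C √ε) (.of_forall hnonneg)
    _ = 2 * Real.pi * B₁ * √ε / |Real.log ε| := by
      rw [integral_indicator_div_norm C (Real.sqrt_nonneg ε)]
      ring
end

section
/- Let ψ : ℝ → ℝ be infinitely smooth with ψ(s) = 1 for s ≤ 1/2 and ψ(s) = 0 for s ≥ 1, and for 0 < ε < 1 define Φ_ε : ℝ² → ℝ by Φ_ε(x) = ψ(|ln‖x‖| / |ln ε|) for x ≠ 0 and Φ_ε(0) = 0. Let R ≥ 1, let Ω ⊆ {x ∈ ℝ² : ‖x‖ ≤ R} be measurable, let l ∈ ℕ, and let u₁, …, u_l : ℝ² → ℂ be measurable functions that are orthonormal in L²(Ω) and satisfy |u_j(x)| ≤ B for all x ∈ Ω and all j. Then for every ε with 0 < ε < R⁻² and every b = (b₁, …, b_l) ∈ ℂˡ, one has ∫_Ω |Σⱼ bⱼ Φ_ε(x) u_j(x)|² dx ≥ (1 − l π B² ε) · Σⱼ |bⱼ|². -/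
open scoped Classical

open MeasureTheory

/-- A continuous function that is constant on both sides of a compact interval is bounded. -/
theorem exists_bound_of_eq_one_of_eq_zero {ψ : ℝ → ℝ} (hψ : Continuous ψ)
    (hψ1 : ∀ s : ℝ, s ≤ 1 / 2 → ψ s = 1) (hψ0 : ∀ s : ℝ, 1 ≤ s → ψ s = 0) :
    ∃ M : ℝ, ∀ s, |ψ s| ≤ M := by
  obtain ⟨M, hM⟩ := (isCompact_Icc (a := (1 / 2 : ℝ)) (b := 1)).exists_bound_of_continuousOn
    hψ.continuousOn
  refine ⟨max M 1, fun s => ?_⟩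
  rcases le_total s (1 / 2) with h | h
  · simp [hψ1 s h]
  rcases le_total 1 s with h' | h'
  · simp [hψ0 s h']
  · exact (hM s ⟨h, h'⟩).trans (le_max_left _ _)

theorem measurable_cutoff {ψ : ℝ → ℝ} (hψ : Measurable ψ) (ε : ℝ) :
    Measurable (cutoff ψ ε) :=
  Measurable.ite (measurableSet_singleton 0) measurable_const (by fun_prop)

theorem cutoff_eq_one {ψ : ℝ → ℝ} (hψ1 : ∀ s : ℝ, s ≤ 1 / 2 → ψ s = 1) {ε R : ℝ}
    (hε : 0 < ε) (hε1 : ε < 1) (hεR : ε < (R ^ 2)⁻¹)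
    {x : EuclideanSpace ℝ (Fin 2)} (hx : √ε < ‖x‖) (hxR : ‖x‖ ≤ R) :
    cutoff ψ ε x = 1 := by
  have hx0 : 0 < ‖x‖ := (Real.sqrt_nonneg ε).trans_lt hx
  have hlog : Real.log ε < 0 := Real.log_neg hε hε1
  have hlower : Real.log ε / 2 < Real.log ‖x‖ := by
    rw [← Real.log_sqrt hε.le]
    exact Real.log_lt_log (Real.sqrt_pos.2 hε) hx
  have hupper : Real.log ‖x‖ ≤ -Real.log ε / 2 := by
    have h1 := Real.log_le_log hx0 hxR
    have h2 := Real.log_lt_log hε hεR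
    rw [Real.log_inv, Real.log_pow] at h2
    push_cast at h2
    linarith
  rw [cutoff, if_neg (norm_pos_iff.1 hx0)]
  apply hψ1
  rw [div_le_iff₀ (abs_pos.2 hlog.ne), abs_of_neg hlog, abs_le]
  constructor <;> linarith

theorem norm_sum_mul_sq_le {ι : Type*} [Fintype ι] (b v : ι → ℂ) {B : ℝ}
    (hv : ∀ j, ‖v j‖ ≤ B) :
    ‖∑ j, b j * v j‖ ^ 2 ≤ (Fintype.card ι : ℝ) * B ^ 2 * ∑ j, ‖b j‖ ^ 2 := by
  have h1 : ‖∑ j, b j * v j‖ ≤ ∑ j, ‖b j‖ * ‖v j‖ := by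
    simpa only [norm_mul] using norm_sum_le Finset.univ fun j => b j * v j
  have h2 : ∑ j, ‖v j‖ ^ 2 ≤ (Fintype.card ι : ℝ) * B ^ 2 := by
    simpa using Finset.sum_le_sum fun j (_ : j ∈ Finset.univ) =>
      pow_le_pow_left₀ (norm_nonneg (v j)) (hv j) 2
  calc ‖∑ j, b j * v j‖ ^ 2 ≤ (∑ j, ‖b j‖ * ‖v j‖) ^ 2 := by gcongr
    _ ≤ (∑ j, ‖b j‖ ^ 2) * ∑ j, ‖v j‖ ^ 2 := Finset.sum_mul_sq_le_sq_mul_sq _ _ _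
    _ ≤ (∑ j, ‖b j‖ ^ 2) * ((Fintype.card ι : ℝ) * B ^ 2) := by gcongr
    _ = _ := mul_comm _ _

theorem integral_norm_sum_sq_of_orthonormal {α ι : Type*} [MeasurableSpace α] [Fintype ι]
    [DecidableEq ι] {μ : Measure α} {u : ι → α → ℂ}
    (hint : ∀ j s, Integrable (fun x => (starRingEnd ℂ) (u j x) * u s x) μ)
    (horth : ∀ j s, (∫ x, (starRingEnd ℂ) (u j x) * u s x ∂μ) = if j = s then 1 else 0)
    (b : ι → ℂ) :
    ∫ x, ‖∑ j, b j * u j x‖ ^ 2 ∂μ = ∑ j, ‖b j‖ ^ 2 := by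
  apply Complex.ofReal_injective
  have hexp (x : α) : ((‖∑ j, b j * u j x‖ ^ 2 : ℝ) : ℂ) =
      ∑ j, ∑ s, ((starRingEnd ℂ) (b j) * b s) * ((starRingEnd ℂ) (u j x) * u s x) := by
    rw [Complex.ofReal_pow, ← Complex.conj_mul', map_sum, Finset.sum_mul_sum]
    refine Finset.sum_congr rfl fun j _ => Finset.sum_congr rfl fun s _ => ?_
    rw [map_mul]
    ring
  rw [← integral_complex_ofReal]
  simp_rw [hexp]
  rw [integral_finsetSum _ fun j _ => integrable_finsetSum _ fun s _ => (hint j s).const_mul _]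
  simp_rw [integral_finsetSum _ fun s _ => (hint _ s).const_mul _, integral_const_mul, horth]
  simp [Complex.conj_mul']

theorem stmt14 (ψ : ℝ → ℝ) (hψ : ContDiff ℝ (⊤ : ℕ∞) ψ)
    (hψ1 : ∀ s : ℝ, s ≤ 1 / 2 → ψ s = 1) (hψ0 : ∀ s : ℝ, 1 ≤ s → ψ s = 0)
    (ε : ℝ) (hε : 0 < ε) (hε1 : ε < 1)
    (R : ℝ) (hR : 1 ≤ R)
    (Ω : Set (EuclideanSpace ℝ (Fin 2))) (hΩmeas : MeasurableSet Ω)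
    (hΩ : Ω ⊆ Metric.closedBall (0 : EuclideanSpace ℝ (Fin 2)) R)
    (l : ℕ) (u : Fin l → EuclideanSpace ℝ (Fin 2) → ℂ)
    (humeas : ∀ j, Measurable (u j))
    (horth : ∀ j s : Fin l,
      (∫ x in Ω, (starRingEnd ℂ) (u j x) * u s x) = if j = s then 1 else 0)
    (B : ℝ) (hub : ∀ (j : Fin l), ∀ x ∈ Ω, ‖u j x‖ ≤ B)
    (hεR : ε < (R ^ 2)⁻¹) (b : Fin l → ℂ) :
    (1 - (l : ℝ) * Real.pi * B ^ 2 * ε) * ∑ j, ‖b j‖ ^ 2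
      ≤ ∫ x in Ω, ‖∑ j, b j * ((cutoff ψ ε x : ℝ) : ℂ) * u j x‖ ^ 2 := by
  have hΩfin : volume Ω ≠ ⊤ := ((measure_mono hΩ).trans_lt measure_closedBall_lt_top).ne
  have : IsFiniteMeasure (volume.restrict Ω) := isFiniteMeasure_restrict.2 hΩfin
  have hΦ := measurable_cutoff hψ.continuous.measurable ε
  obtain ⟨M, hM⟩ := exists_bound_of_eq_one_of_eq_zero hψ.continuous hψ1 hψ0
  have hM0 : 0 ≤ M := (abs_nonneg _).trans (hM 0)
  have hΦM (x) : |cutoff ψ ε x| ≤ M := by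
    unfold cutoff
    split_ifs
    · simpa using hM0
    · exact hM _
  set C : ℝ := (l : ℝ) * B ^ 2 * ∑ j, ‖b j‖ ^ 2 with hC
  have hC0 : 0 ≤ C := by positivity
  set F : EuclideanSpace ℝ (Fin 2) → ℂ := fun x => ∑ j, b j * u j x with hF
  have hFmeas : Measurable F := by fun_prop
  have hFC : ∀ x ∈ Ω, ‖F x‖ ^ 2 ≤ C := fun x hx => by
    simpa using norm_sum_mul_sq_le b (fun j => u j x) fun j => hub j x hx
  have hfactor (x) : ‖∑ j, b j * ((cutoff ψ ε x : ℝ) : ℂ) * u j x‖ ^ 2 =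
      cutoff ψ ε x ^ 2 * ‖F x‖ ^ 2 := by
    rw [← sq_abs (cutoff ψ ε x), ← Real.norm_eq_abs, ← Complex.norm_real, ← mul_pow, ← norm_mul,
      hF, Finset.mul_sum]
    congr 2
    exact Finset.sum_congr rfl fun j _ => by ring
  simp_rw [hfactor]
  have hFint : IntegrableOn (fun x => ‖F x‖ ^ 2) Ω :=
    Integrable.of_bound (by fun_prop) C <| (ae_restrict_iff' hΩmeas).2 <| .of_forall fun x hx => by
      simpa using hFC x hx
  have hΦFint : IntegrableOn (fun x => cutoff ψ ε x ^ 2 * ‖F x‖ ^ 2) Ω :=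
    Integrable.of_bound (by fun_prop) (M ^ 2 * C) <| (ae_restrict_iff' hΩmeas).2 <|
      .of_forall fun x hx => by
        rw [Real.norm_of_nonneg (by positivity), ← sq_abs (cutoff ψ ε x)]
        gcongr
        exacts [hΦM x, hFC x hx]
  have hortho : ∫ x in Ω, ‖F x‖ ^ 2 = ∑ j, ‖b j‖ ^ 2 := by
    refine integral_norm_sum_sq_of_orthonormal (fun j s => ?_) (fun j s => ?_) b
    · refine Integrable.of_bound ?_ (B * B) <|
        (ae_restrict_iff' hΩmeas).2 <| .of_forall fun x hx => ?_
      · exact ((Complex.continuous_conj.measurable.comp (humeas j)).mul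
          (humeas s)).aestronglyMeasurable
      · rw [norm_mul, RCLike.norm_conj]
        exact mul_le_mul (hub j x hx) (hub s x hx) (norm_nonneg _)
          ((norm_nonneg _).trans (hub j x hx))
    · rw [horth j s]
  set D := Metric.closedBall (0 : EuclideanSpace ℝ (Fin 2)) √ε
  have hD : MeasurableSet D := measurableSet_closedBall
  have hDvol : volume.real D = Real.pi * ε := by
    simp [D, Measure.real, EuclideanSpace.volume_closedBall_fin_two, Real.sq_sqrt hε.le,
      Real.pi_nonneg, mul_comm]
  have hDint : ∫ x in Ω, D.indicator (fun _ => C) x ≤ C * (Real.pi * ε) := by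
    rw [integral_indicator_const _ hD, smul_eq_mul, mul_comm, ← hDvol]
    gcongr
    exact ENNReal.toReal_mono measure_closedBall_lt_top.ne (Measure.restrict_apply_le _ _)
  have hDintegrable : IntegrableOn (D.indicator fun _ => C) Ω := (integrable_const C).indicator hD
  calc (1 - (l : ℝ) * Real.pi * B ^ 2 * ε) * ∑ j, ‖b j‖ ^ 2
      = ∑ j, ‖b j‖ ^ 2 - C * (Real.pi * ε) := by rw [hC]; ring
    _ ≤ ∫ x in Ω, (‖F x‖ ^ 2 - D.indicator (fun _ => C) x) := by
      rw [integral_sub hFint hDintegrable, hortho]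
      linarith
    _ ≤ ∫ x in Ω, cutoff ψ ε x ^ 2 * ‖F x‖ ^ 2 := by
      refine setIntegral_mono_on (hFint.sub hDintegrable) hΦFint hΩmeas fun x hx => ?_
      by_cases hxD : x ∈ D
      · rw [Set.indicator_of_mem hxD]
        have := hFC x hx
        have : 0 ≤ cutoff ψ ε x ^ 2 * ‖F x‖ ^ 2 := by positivity
        linarith
      · have hxR := hΩ hx
        rw [mem_closedBall_zero_iff] at hxR
        rw [mem_closedBall_zero_iff, not_le] at hxD
        rw [cutoff_eq_one hψ1 hε hε1 hεR hxD hxR,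
          Set.indicator_of_notMem (by simpa [D] using hxD)]
        simp
end

section
/- Define s : ℝ² → ℝ by s(ξ) = (‖ξ − (1,0)‖ + ‖ξ + (1,0)‖)/2 and u : ℝ² → ℝ by u(ξ) = ln(s(ξ) + √(s(ξ)² − 1)). Then u(ξ) − ln‖ξ‖ − ln 2 = O(‖ξ‖⁻²) as ‖ξ‖ → ∞; that is, there exist constants C > 0 and R > 0 such that |u(ξ) − ln‖ξ‖ − ln 2| ≤ C ‖ξ‖⁻² whenever ‖ξ‖ ≥ R. -/
/-- `s(ξ) = (‖ξ − (1,0)‖ + ‖ξ + (1,0)‖)/2` (Euclidean distances written explicitly). -/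
noncomputable def sFun (p : ℝ × ℝ) : ℝ :=
  (Real.sqrt ((p.1 - 1) ^ 2 + p.2 ^ 2) + Real.sqrt ((p.1 + 1) ^ 2 + p.2 ^ 2)) / 2

/-- `u(ξ) = ln(s(ξ) + √(s(ξ)² − 1))`. -/
noncomputable def uFun (p : ℝ × ℝ) : ℝ :=
  Real.log (sFun p + Real.sqrt ((sFun p) ^ 2 - 1))

/-- Euclidean norm of `ξ ∈ ℝ²`. -/
noncomputable def eNorm (p : ℝ × ℝ) : ℝ := Real.sqrt (p.1 ^ 2 + p.2 ^ 2)

theorem eNorm_sq (p : ℝ × ℝ) : eNorm p ^ 2 = p.1 ^ 2 + p.2 ^ 2 :=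
  Real.sq_sqrt (by positivity)

theorem sFun_nonneg (p : ℝ × ℝ) : 0 ≤ sFun p := by
  unfold sFun; positivity

/-- The parallelogram law gives `s² = (‖ξ‖² + 1 + ab) / 2`, where `a`, `b` are the distances from
`ξ` to the foci; the bounds come from `‖ξ‖² - 1 ≤ ab ≤ ‖ξ‖² + 1`. -/
theorem sFun_sq_mem_Icc (p : ℝ × ℝ) :
    sFun p ^ 2 ∈ Set.Icc (eNorm p ^ 2) (eNorm p ^ 2 + 1) := by
  rw [eNorm_sq, sFun]
  have ha := Real.sq_sqrt (show 0 ≤ (p.1 - 1) ^ 2 + p.2 ^ 2 by positivity)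
  have hb := Real.sq_sqrt (show 0 ≤ (p.1 + 1) ^ 2 + p.2 ^ 2 by positivity)
  have ha0 := Real.sqrt_nonneg ((p.1 - 1) ^ 2 + p.2 ^ 2)
  have hb0 := Real.sqrt_nonneg ((p.1 + 1) ^ 2 + p.2 ^ 2)
  set a := Real.sqrt ((p.1 - 1) ^ 2 + p.2 ^ 2)
  set b := Real.sqrt ((p.1 + 1) ^ 2 + p.2 ^ 2)
  have hab : (a * b) ^ 2 = (p.1 ^ 2 + p.2 ^ 2 - 1) ^ 2 + 4 * p.2 ^ 2 := by
    rw [mul_pow, ha, hb]; ring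
  have hlow : p.1 ^ 2 + p.2 ^ 2 - 1 ≤ a * b :=
    le_of_abs_le (abs_le_of_sq_le_sq (by rw [hab]; nlinarith [sq_nonneg p.2]) (by positivity))
  constructor
  · nlinarith
  · nlinarith [sq_nonneg (a - b)]

theorem stmt16 :
    ∃ C > (0 : ℝ), ∃ R > (0 : ℝ), ∀ p : ℝ × ℝ, R ≤ eNorm p →
      |uFun p - Real.log (eNorm p) - Real.log 2| ≤ C * ((eNorm p) ^ 2)⁻¹ := by
  refine ⟨1, one_pos, 1, one_pos, fun p hr => ?_⟩
  obtain ⟨hl, hu⟩ := sFun_sq_mem_Icc p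
  have hs := sFun_nonneg p
  unfold uFun
  set r := eNorm p
  set s := sFun p
  have hr0 : 0 < r := by linarith
  have hinv : r * r⁻¹ = 1 := mul_inv_cancel₀ hr0.ne'
  have hi0 : 0 < r⁻¹ := inv_pos.mpr hr0
  have hi1 : r⁻¹ ≤ 1 := inv_le_one_of_one_le₀ hr
  have hsl : r ≤ s := by nlinarith
  have hsu : s ≤ r + r⁻¹ := by nlinarith
  have hql : r - r⁻¹ ≤ √(s ^ 2 - 1) := Real.le_sqrt_of_sq_le (by nlinarith)
  have hqu : √(s ^ 2 - 1) ≤ r := Real.sqrt_le_iff.mpr ⟨hr0.le, by linarith⟩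
  have hq0 := Real.sqrt_nonneg (s ^ 2 - 1)
  set T := s + √(s ^ 2 - 1) with hT
  have hT0 : 0 < T := by linarith
  have hlog : Real.log T - Real.log r - Real.log 2 = Real.log (T / (2 * r)) := by
    rw [Real.log_div hT0.ne' (by positivity), Real.log_mul two_ne_zero hr0.ne']; ring
  rw [hlog, one_mul, abs_le]
  constructor
  · refine le_trans ?_ (Real.one_sub_inv_le_log_of_pos (by positivity))
    have : 2 * r / T ≤ 1 + (r ^ 2)⁻¹ := by
      rw [div_le_iff₀ hT0, ← inv_pow]
      nlinarith [mul_le_mul_of_nonneg_left (show r ≤ T by linarith) (sq_nonneg r⁻¹)]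
    rw [inv_div]; linarith
  · refine (Real.log_le_sub_one_of_pos (by positivity)).trans ?_
    have : T / (2 * r) ≤ 1 + (r ^ 2)⁻¹ := by
      rw [div_le_iff₀ (by positivity), ← inv_pow]
      nlinarith
    linarith
end

section
/- Define s : ℝ² → ℝ by s(ξ) = (‖ξ − (1,0)‖ + ‖ξ + (1,0)‖)/2 and u : ℝ² → ℝ by u(ξ) = ln(s(ξ) + √(s(ξ)² − 1)). Then: (a) u(ξ₁, 0) = 0 for every ξ₁ with |ξ₁| ≤ 1 (u vanishes on the window segment); and (b) for every ξ₁ with |ξ₁| > 1, the function t ↦ u(ξ₁, t) is differentiable at t = 0 with derivative 0 (Neumann condition on the cut Γ* = {(ξ₁, 0) : |ξ₁| > 1}). -/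
theorem sFun_axis (x : ℝ) : sFun (x, 0) = max 1 |x| := by
  have h : sFun (x, 0) = (|x - 1| + |x + 1|) / 2 := by
    simp [sFun, Real.sqrt_sq_eq_abs]
  rw [h]
  rcases abs_cases (x - 1) with h1 | h1 <;> rcases abs_cases (x + 1) with h2 | h2 <;>
    rcases abs_cases x with h3 | h3 <;> rcases max_cases 1 |x| with h4 | h4 <;> linarith

theorem hasDerivAt_sqrt_sq_add_sq {a : ℝ} (ha : a ≠ 0) :
    HasDerivAt (fun t : ℝ => Real.sqrt (a ^ 2 + t ^ 2)) 0 0 := by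
  have h : HasDerivAt (fun t : ℝ => a ^ 2 + t ^ 2) 0 0 := by
    simpa using (hasDerivAt_pow 2 (0 : ℝ)).const_add (a ^ 2)
  simpa using h.sqrt (by simpa using ha)

theorem hasDerivAt_sFun_normal {x : ℝ} (hx : 1 < |x|) :
    HasDerivAt (fun t : ℝ => sFun (x, t)) 0 0 := by
  have h1 : x - 1 ≠ 0 := by
    intro h
    rw [sub_eq_zero.mp h] at hx
    simp at hx
  have h2 : x + 1 ≠ 0 := by
    intro h
    rw [eq_neg_of_add_eq_zero_left h] at hx
    simp at hx
  simpa [sFun] using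
    ((hasDerivAt_sqrt_sq_add_sq h1).add (hasDerivAt_sqrt_sq_add_sq h2)).div_const 2

theorem differentiableAt_log_add_sqrt {s : ℝ} (hs : 1 < s) :
    DifferentiableAt ℝ (fun r : ℝ => Real.log (r + Real.sqrt (r ^ 2 - 1))) s := by
  have h1 : s ^ 2 - 1 ≠ 0 := by nlinarith
  have h2 : s + Real.sqrt (s ^ 2 - 1) ≠ 0 := by positivity
  fun_prop (disch := assumption)

theorem stmt17 :
    (∀ ξ₁ : ℝ, |ξ₁| ≤ 1 → uFun (ξ₁, 0) = 0) ∧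
    (∀ ξ₁ : ℝ, 1 < |ξ₁| → HasDerivAt (fun t : ℝ => uFun (ξ₁, t)) 0 0) := by
  refine ⟨fun x hx => ?_, fun x hx => ?_⟩
  · simp [uFun, sFun_axis, max_eq_left hx]
  · have hs : 1 < sFun (x, 0) := by rw [sFun_axis]; exact lt_max_of_lt_right hx
    simpa [uFun, Function.comp_def] using
      (differentiableAt_log_add_sqrt hs).hasDerivAt.comp (0 : ℝ) (hasDerivAt_sFun_normal hx)
end
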